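/- Let k ≥ 1 be an integer, let p₁, …, p_k ∈ ℝ² be points, let n₁, …, n_k be positive integers, and let v ∈ ℝ² be a nonzero vector. Then there do not exist continuous injective maps φ₁, …, φ_k : [0,1] → ℝ² satisfying all of the following: (1) φᵢ(0) = pᵢ and φᵢ(1) = p_{i+1} + n_{i+1}·v for every 1 ≤ i ≤ k, where indices are cyclic so that p_{k+1} = p₁ and n_{k+1} = n₁; (2) the image of φᵢ is disjoint from its translate by v, i.e., φᵢ([0,1]) ∩ (φᵢ([0,1]) + v) = ∅, for every 1 ≤ i ≤ k; (3) the images of φᵢ and φⱼ are disjoint for every 1 ≤ i < j ≤ k. -/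

import Mathlib

namespace CurveAux
open Set Filter Topology

lemma exists_log_lift {A : Type*} [TopologicalSpace A] [SimplyConnectedSpace A]
    [LocallyPathConnectedSpace A] (g : A → ℂ) (hg : Continuous g) (h0 : ∀ a, g a ≠ 0) :
    ∃ L : A → ℂ, Continuous L ∧ ∀ a, Complex.exp (L a) = g a := by
  obtain ⟨a₀⟩ : Nonempty A := inferInstance
  obtain ⟨F, ⟨-, hF⟩, -⟩ := Complex.isCoveringMapOn_exp.existsUnique_continuousMap_lifts
    (⟨g, hg⟩ : C(A, ℂ)) (a₀ := a₀) (e₀ := Complex.log (g a₀)) (by simp [Complex.exp_log (h0 a₀)])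
    (by intro a; simpa using h0 a)
  exact ⟨F, F.continuous, fun a => congrFun hF a⟩

lemma const_of_exp_const {X : Type*} [TopologicalSpace X] {s : Set X} (hs : IsPreconnected s)
    (g : X → ℂ) (hg : ContinuousOn g s) (w : ℂ) (h : ∀ x ∈ s, Complex.exp (g x) = w)
    {x y : X} (hx : x ∈ s) (hy : y ∈ s) : g x = g y := by
  have hc : (g '' s).Countable := by
    have : g '' s ⊆ range (fun n : ℤ => g x + n * (2 * Real.pi * Complex.I)) := by
      rintro _ ⟨z, hz, rfl⟩
      obtain ⟨n, hn⟩ := Complex.exp_eq_exp_iff_exists_int.1 ((h z hz).trans (h x hx).symm)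
      exact ⟨n, hn.symm⟩
    exact (countable_range _).mono this
  have := (hs.image g hg)
  exact hc.isTotallyDisconnected _ subset_rfl this (mem_image_of_mem g hx) (mem_image_of_mem g hy)


lemma winding_contra (f : ℂ → ℂ) (hfc : Continuous f) (hfix : ∀ z, f z ≠ z)
    (F : ℝ × ℂ → ℂ) (hF : Continuous F) (hF0 : ∀ z, F (0, z) = z) (hF1 : ∀ z, F (1, z) = f z)
    (hFi : ∀ u x y, F (u, x) = F (u, y) → x = y)
    (N : ℝ) (hN : 2 ≤ N) (Γ : ℝ → ℂ) (hΓ : Continuous Γ) (hshift : ∀ t, Γ (t + 1) = f (Γ t))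
    (hper : Γ N = Γ 0)
    (hne : ∀ s t, 0 ≤ s → t ≤ N → 1 ≤ t - s → t - s ≤ N - 1 → Γ s ≠ Γ t) : False := by
  obtain ⟨ψ, hψc, hψ⟩ := exists_log_lift (fun z => f z - z) (hfc.sub continuous_id)
    (fun z => sub_ne_zero.2 (hfix z))
  set C : ℝ × ℝ × ℝ → ℝ := fun q => max 1 (min q.2.2 (N - 1)) with hC
  set S : ℝ × ℝ × ℝ → ℝ := fun q => max 0 (min q.2.1 (N - C q)) with hS
  have hCc : Continuous C := by fun_prop
  have hSc : Continuous S := by fun_prop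
  have hC1 : ∀ q, 1 ≤ C q := fun q => le_max_left _ _
  have hC2 : ∀ q, C q ≤ N - 1 := fun q => max_le (by linarith) (min_le_right _ _)
  have hS1 : ∀ q, 0 ≤ S q := fun q => le_max_left _ _
  have hS2 : ∀ q, S q ≤ N - C q := fun q => max_le (by linarith [hC2 q]) (min_le_right _ _)
  obtain ⟨Θ, hΘc, hΘ⟩ := exists_log_lift
    (fun q : ℝ × ℝ × ℝ => F (q.1, Γ (S q + C q)) - F (q.1, Γ (S q))) (by fun_prop)
    (fun q => by
      refine sub_ne_zero.2 fun h => ?_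
      refine hne (S q) (S q + C q) (hS1 q) (by linarith [hS2 q]) (by linarith [hC1 q])
        (by linarith [hC2 q]) (hFi _ _ _ h).symm)
  have hval : ∀ u s c, 1 ≤ c → c ≤ N - 1 → 0 ≤ s → s + c ≤ N →
      Complex.exp (Θ (u, s, c)) = F (u, Γ (s + c)) - F (u, Γ s) := by
    intro u s c h1 h2 h3 h4
    have e1 : C (u, s, c) = c := by simp only [hC]; rw [min_eq_left h2, max_eq_right h1]
    have e2 : S (u, s, c) = s := by
      simp only [hS]; rw [e1, min_eq_left (by linarith), max_eq_right h3]
    rw [hΘ, e1, e2]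
  have hnz : ∀ u s c, 1 ≤ c → c ≤ N - 1 → 0 ≤ s → s + c ≤ N →
      F (u, Γ (s + c)) - F (u, Γ s) ≠ 0 := by
    intro u s c h1 h2 h3 h4
    rw [← hval u s c h1 h2 h3 h4]; exact Complex.exp_ne_zero _
  -- the half turn
  have Hh : ∀ u a, 1 ≤ a → a ≤ N - 1 →
      Complex.exp (Θ (u, a, N - a) - Θ (u, 0, a)) = -1 := by
    intro u a h1 h2
    have h3 := hnz u 0 a h1 h2 le_rfl (by linarith)
    rw [Complex.exp_sub, hval u a (N - a) (by linarith) (by linarith) (by linarith) (by linarith),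
      hval u 0 a h1 h2 le_rfl (by linarith), div_eq_iff h3]
    simp [hper]
  have Hconst : Θ (0, 1, N - 1) - Θ (0, 0, 1) = Θ (1, N - 1, N - (N - 1)) - Θ (1, 0, N - 1) := by
    have hp : IsPreconnected ((univ : Set ℝ) ×ˢ Icc (1 : ℝ) (N - 1)) :=
      isPreconnected_univ.prod isPreconnected_Icc
    exact const_of_exp_const hp (fun q : ℝ × ℝ => Θ (q.1, q.2, N - q.2) - Θ (q.1, 0, q.2))
      (Continuous.continuousOn (by fun_prop)) (-1) (fun q hq => Hh q.1 q.2 hq.2.1 hq.2.2)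
      (x := (0, 1)) (y := (1, N - 1)) ⟨trivial, by constructor <;> linarith⟩
      ⟨trivial, by constructor <;> dsimp only <;> linarith⟩
  have H1 : Θ (0, 0, 1) - ψ (Γ 0) = Θ (0, N - 1, 1) - ψ (Γ (N - 1)) := by
    refine const_of_exp_const (isPreconnected_Icc (a := (0:ℝ)) (b := N - 1))
      (fun s : ℝ => Θ (0, s, 1) - ψ (Γ s))
      (Continuous.continuousOn (by fun_prop)) 1 (fun s hs => ?_) ⟨le_rfl, by linarith⟩
      ⟨by linarith, le_rfl⟩
    rw [Complex.exp_sub, hval 0 s 1 le_rfl (by linarith) hs.1 (by linarith [hs.2]), hψ, hF0, hF0,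
      hshift, div_self (sub_ne_zero.2 (hfix _))]
  have H2 : Θ (1, N - 2, 1) - ψ (Γ (N - 2 + 1)) = Θ (1, N - 1, 1) - ψ (Γ (N - 1 + 1)) := by
    refine const_of_exp_const (isPreconnected_Icc (a := (0:ℝ)) (b := N - 1))
      (fun s : ℝ => Θ (1, s, 1) - ψ (Γ (s + 1)))
      (Continuous.continuousOn (by fun_prop)) 1 (fun s hs => ?_) ⟨by linarith, by linarith⟩
      ⟨by linarith, le_rfl⟩
    rw [Complex.exp_sub, hval 1 s 1 le_rfl (by linarith) hs.1 (by linarith [hs.2]), hψ, hF1, hF1,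
      ← hshift s, div_self (sub_ne_zero.2 (hfix _))]
  have H3 : Θ (0, 1, N - 1) - Θ (1, 1 - 1, N - 1) =
      Θ (0, N - 1, N - (N - 1)) - Θ (1, N - 1 - 1, N - (N - 1)) := by
    refine const_of_exp_const (isPreconnected_Icc (a := (1:ℝ)) (b := N - 1))
      (fun s : ℝ => Θ (0, s, N - s) - Θ (1, s - 1, N - s))
      (Continuous.continuousOn (by fun_prop)) 1 (fun s hs => ?_) ⟨by linarith, by linarith⟩
      ⟨by linarith, le_rfl⟩
    have hs1 := hs.1
    have hs2 := hs.2
    have h0 := hnz 0 s (N - s) (by linarith) (by linarith) (by linarith) (by linarith)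
    rw [Complex.exp_sub, hval 0 s (N - s) (by linarith) (by linarith) (by linarith) (by linarith),
      hval 1 (s - 1) (N - s) (by linarith) (by linarith) (by linarith) (by linarith),
      hF1, hF1, ← hshift, ← hshift]
    have e1 : s - 1 + (N - s) + 1 = s + (N - s) := by ring
    have e2 : s - 1 + 1 = s := by ring
    rw [e1, e2]
    rw [hF0, hF0] at h0 ⊢
    exact div_self h0
  have h := Hh 0 1 le_rfl (by linarith)
  have e1 : N - (N - 1) = 1 := by ring
  have e2 : N - 1 - 1 = N - 2 := by ring
  have e3 : N - 2 + 1 = N - 1 := by ring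
  have e4 : N - 1 + 1 = N := by ring
  rw [e1] at H3 Hconst
  rw [e2, sub_self] at H3
  rw [e3, e4, hper] at H2
  have hz : Θ (0, 1, N - 1) - Θ (0, 0, 1) = 0 := by
    linear_combination (1/2) * Hconst + (1/2) * H3 - (1/2) * H1 - (1/2) * H2
  rw [hz, Complex.exp_zero] at h
  norm_num at h

def IsoId (f : ℂ → ℂ) : Prop :=
  ∃ F : ℝ × ℂ → ℂ, Continuous F ∧ (∀ z, F (0, z) = z) ∧ (∀ z, F (1, z) = f z) ∧
    ∀ u x y, F (u, x) = F (u, y) → x = y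

lemma IsoId.comp {f g : ℂ → ℂ} (hf : IsoId f) (hg : IsoId g) : IsoId (fun z => f (g z)) := by
  obtain ⟨F, hF, hF0, hF1, hFi⟩ := hf
  obtain ⟨G, hG, hG0, hG1, hGi⟩ := hg
  refine ⟨fun q => F (q.1, G q), by fun_prop, fun z => by simp [hF0, hG0],
    fun z => by simp [hF1, hG1], fun u x y h => hGi u x y (hFi u _ _ h)⟩

lemma isoId_id : IsoId (fun z => z) :=
  ⟨fun q => q.2, by fun_prop, fun _ => rfl, fun _ => rfl, fun _ _ _ h => h⟩

lemma push_ball (a b : ℂ) (r : ℝ) (hab : dist b a < r) :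
    ∃ h : ℂ ≃ₜ ℂ, IsoId h ∧ h a = b ∧ ∀ x, x ∉ Metric.ball a r → h x = x := by
  have hr : 0 < r := dist_nonneg.trans_lt hab
  set ρ : ℂ → ℝ := fun x => max 0 (1 - dist x a / r) with hρ
  have hρc : Continuous ρ := by fun_prop
  have hρl : ∀ x y, |ρ x - ρ y| ≤ dist x y / r := by
    intro x y
    have h1 : |ρ x - ρ y| ≤ |(1 - dist x a / r) - (1 - dist y a / r)| := by
      simp only [hρ]
      rw [max_comm 0, max_comm 0]
      exact abs_max_sub_max_le_abs _ _ _
    refine h1.trans ?_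
    have : (1 - dist x a / r) - (1 - dist y a / r) = (dist y a - dist x a) / r := by ring
    rw [this, abs_div, abs_of_pos hr]
    gcongr
    rw [dist_comm x y]
    exact abs_dist_sub_le y x a
  have hcontr : ∀ u : ℝ, 0 ≤ u → u ≤ 1 → ∀ x y : ℂ,
      ‖((u * ρ x : ℝ) : ℂ) * (b - a) - ((u * ρ y : ℝ) : ℂ) * (b - a)‖
        ≤ dist b a / r * ‖x - y‖ := by
    intro u h0 h1 x y
    have : ((u * ρ x : ℝ) : ℂ) * (b - a) - ((u * ρ y : ℝ) : ℂ) * (b - a)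
      = ((u * (ρ x - ρ y) : ℝ) : ℂ) * (b - a) := by push_cast; ring
    rw [this, norm_mul, Complex.norm_real, Real.norm_eq_abs, abs_mul, abs_of_nonneg h0,
      ← dist_eq_norm b a, ← dist_eq_norm x y]
    have h2 := hρl x y
    calc u * |ρ x - ρ y| * dist b a ≤ 1 * (dist x y / r) * dist b a := by gcongr
      _ = _ := by ring
  have hlt : dist b a / r < 1 := (div_lt_one hr).2 hab
  have happ : ApproximatesLinearOn (fun x : ℂ => x + ((1 * ρ x : ℝ) : ℂ) * (b - a))
      ((ContinuousLinearEquiv.refl ℝ ℂ : ℂ ≃L[ℝ] ℂ) : ℂ →L[ℝ] ℂ) univ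
      (Real.toNNReal (dist b a / r)) := by
    intro x _ y _
    have := hcontr 1 zero_le_one le_rfl x y
    simp only [ContinuousLinearEquiv.coe_coe, ContinuousLinearEquiv.refl_apply]
    rw [Real.coe_toNNReal _ (by positivity)]
    refine le_trans (le_of_eq ?_) this
    congr 1; ring
  let h := happ.toHomeomorph _ (Or.inr (by
    simp
    exact hlt))
  have hh : ∀ x, h x = x + ((1 * ρ x : ℝ) : ℂ) * (b - a) := fun x => rfl
  refine ⟨h, ⟨fun q => q.2 + ((max 0 (min q.1 1) * ρ q.2 : ℝ) : ℂ) * (b - a), by fun_prop, 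
    by simp, fun z => by simp [hh], ?_⟩, ?_, ?_⟩
  · intro u x y hxy
    by_contra hne
    have h1 := hcontr (max 0 (min u 1)) (le_max_left _ _)
      (max_le zero_le_one (min_le_right _ _)) x y
    dsimp only at hxy
    have h2 : ((max 0 (min u 1) * ρ x : ℝ) : ℂ) * (b - a) - ((max 0 (min u 1) * ρ y : ℝ) : ℂ) * (b - a)
      = y - x := by linear_combination hxy
    rw [h2, norm_sub_rev y x] at h1
    have h3 : 0 < ‖x - y‖ := norm_pos_iff.2 (sub_ne_zero.2 hne)
    nlinarith
  · simp [hh, hρ]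
  · intro x hx
    have : ρ x = 0 := by
      simp only [Metric.mem_ball, not_lt] at hx
      simp only [hρ]
      apply max_eq_left
      have := (one_le_div hr).2 hx
      linarith
    simp [hh, this]

lemma push_open (U : Set ℂ) (hU : IsOpen U) (hc : IsPreconnected U) {a b : ℂ} (ha : a ∈ U)
    (hb : b ∈ U) : ∃ h : ℂ ≃ₜ ℂ, IsoId h ∧ h a = b ∧ ∀ x, x ∉ U → h x = x := by
  refine hc.induction₂' (fun a b => ∃ h : ℂ ≃ₜ ℂ, IsoId h ∧ h a = b ∧ ∀ x, x ∉ U → h x = x)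
    ?_ ?_ ha hb
  · intro x hx
    obtain ⟨r, hr, hrU⟩ := Metric.isOpen_iff.1 hU x hx
    have hmem : Metric.ball x (r / 2) ∈ 𝓝[U] x :=
      mem_nhdsWithin_of_mem_nhds (Metric.ball_mem_nhds _ (by positivity))
    filter_upwards [hmem] with y hy
    rw [Metric.mem_ball] at hy
    constructor
    · obtain ⟨h, h1, h2, h3⟩ := push_ball x y (r / 2) hy
      exact ⟨h, h1, h2, fun z hz => h3 z fun hzz => hz (hrU (Metric.ball_subset_ball (by linarith) hzz))⟩
    · obtain ⟨h, h1, h2, h3⟩ := push_ball y x (r / 2) (by rwa [dist_comm])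
      refine ⟨h, h1, h2, fun z hz => h3 z fun hzz => hz (hrU ?_)⟩
      rw [Metric.mem_ball] at hzz ⊢
      linarith [dist_triangle z y x]
  · rintro x y z _ _ _ ⟨h, h1, h2, h3⟩ ⟨k, k1, k2, k3⟩
    refine ⟨h.trans k, k1.comp h1, by simp [h2, k2], fun w hw => by simp [h3 w hw, k3 w hw]⟩

lemma mapsTo_of_fix {h : ℂ ≃ₜ ℂ} {U : Set ℂ} (hf : ∀ x, x ∉ U → h x = x) {x : ℂ} (hx : x ∈ U) :
    h x ∈ U := by
  by_contra hn
  have := h.injective (hf _ hn)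
  exact hn (this.symm ▸ hx)

lemma push_multi {ι : Type*} [Finite ι] (U : ι → Set ℂ) (hU : ∀ i, IsOpen (U i))
    (hc : ∀ i, IsPreconnected (U i)) (hd : ∀ i j, i ≠ j → Disjoint (U i) (U j))
    (a b : ι → ℂ) (ha : ∀ i, a i ∈ U i) (hb : ∀ i, b i ∈ U i) :
    ∃ h : ℂ ≃ₜ ℂ, IsoId h ∧ (∀ i, h (a i) = b i) ∧ (∀ i, ∀ x ∈ U i, h x ∈ U i) ∧
      ∀ x, (∀ i, x ∉ U i) → h x = x := by
  classical
  have := Fintype.ofFinite ι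
  have key : ∀ s : Finset ι, ∃ h : ℂ ≃ₜ ℂ, IsoId h ∧ (∀ i ∈ s, h (a i) = b i) ∧
      (∀ i ∉ s, ∀ x ∈ U i, h x = x) ∧ (∀ i, ∀ x ∈ U i, h x ∈ U i) ∧
      ∀ x, (∀ i, x ∉ U i) → h x = x := by
    intro s
    induction s using Finset.induction_on with
    | empty => exact ⟨Homeomorph.refl ℂ, isoId_id, by simp, by simp, by simp, by simp⟩
    | insert j s hj ih =>
      obtain ⟨h, h1, h2, h3, h4, h5⟩ := ih
      obtain ⟨k, k1, k2, k3⟩ := push_open (U j) (hU j) (hc j) (ha j) (hb j)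
      have hoff : ∀ i, i ≠ j → ∀ x ∈ U i, k x = x := fun i hij x hx =>
        k3 x (fun hxj => (hd i j hij).le_bot ⟨hx, hxj⟩)
      refine ⟨h.trans k, k1.comp h1, ?_, ?_, ?_, ?_⟩
      · intro i hi
        rcases Finset.mem_insert.1 hi with rfl | hi'
        · simp [h3 i hj _ (ha i), k2]
        · have : i ≠ j := by rintro rfl; exact hj hi'
          simp [h2 i hi', hoff i this _ (hb i)]
      · intro i hi x hx
        rw [Finset.mem_insert, not_or] at hi
        simp [h3 i hi.2 x hx, hoff i hi.1 x hx]
      · intro i x hx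
        by_cases hij : i = j
        · subst hij; exact mapsTo_of_fix k3 (h4 i x hx)
        · simp only [Homeomorph.trans_apply]
          rw [hoff i hij _ (h4 i x hx)]; exact h4 i x hx
      · intro x hx
        simp [h5 x hx, k3 x (hx j)]
  obtain ⟨h, h1, h2, -, h4, h5⟩ := key Finset.univ
  exact ⟨h, h1, fun i => h2 i (Finset.mem_univ _), h4, h5⟩

/-- chain closing -/
lemma chain_close {ι : Type*} [Finite ι] (f : ℂ ≃ₜ ℂ) (hf : IsoId f) (hfix : ∀ z, f z ≠ z)
    (U : ι → Set ℂ) (hU : ∀ i, IsOpen (U i))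
    (hc : ∀ i, IsPreconnected (U i)) (hd : ∀ i j, i ≠ j → Disjoint (U i) (U j))
    (hfree : ∀ i, ∀ x ∈ U i, f x ∉ U i)
    (a b : ι → ℂ) (ha : ∀ i, a i ∈ U i) (hb : ∀ i, b i ∈ U i)
    (σ : ι → ι) (m : ι → ℕ) (hm : ∀ i, 1 ≤ m i) (hab : ∀ i, f^[m i] (b i) = a (σ i))
    (hout : ∀ i l, 0 < l → l < m i → ∀ j, f^[l] (b i) ∉ U j) :
    ∃ g : ℂ ≃ₜ ℂ, IsoId g ∧ (∀ z, g z ≠ z) ∧ ∀ i, g^[m i] (b i) = b (σ i) := by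
  obtain ⟨h, h1, h2, h3, h4⟩ := push_multi U hU hc hd a b ha hb
  refine ⟨f.trans h, h1.comp hf, ?_, ?_⟩
  · intro z hz
    simp only [Homeomorph.trans_apply] at hz
    by_cases hx : ∀ i, f z ∉ U i
    · rw [h4 _ hx] at hz; exact hfix z hz
    · push Not at hx
      obtain ⟨i, hi⟩ := hx
      have := h3 i _ hi
      rw [hz] at this
      exact hfree i z this hi
  · intro i
    have key : ∀ l, l < m i → (f.trans h)^[l] (b i) = f^[l] (b i) := by
      intro l
      induction l with
      | zero => simp
      | succ l ih =>
        intro hl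
        rw [Function.iterate_succ_apply', ih (by omega), Function.iterate_succ_apply',
          Homeomorph.trans_apply]
        apply h4
        intro j
        rw [← Function.iterate_succ_apply' f]
        exact hout i (l + 1) (by omega) hl j
    obtain ⟨l, hl⟩ : ∃ l, m i = l + 1 := ⟨m i - 1, by have := hm i; omega⟩
    have h5 := hab i
    rw [hl, Function.iterate_succ_apply'] at h5 ⊢
    rw [key l (by omega), Homeomorph.trans_apply, h5, h2]

lemma thicken_free (f : ℂ ≃ₜ ℂ) (K W : Set ℂ) (hK : IsCompact K) (hKc : IsPreconnected K)
    (hW : IsOpen W) (hKW : K ⊆ W) (hfree : ∀ x ∈ K, f x ∉ K) :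
    ∃ U : Set ℂ, IsOpen U ∧ IsPreconnected U ∧ K ⊆ U ∧ U ⊆ W ∧ ∀ x ∈ U, f x ∉ U := by
  rcases K.eq_empty_or_nonempty with rfl | ⟨p, hp⟩
  · exact ⟨∅, isOpen_empty, isPreconnected_empty, by simp, by simp, by simp⟩
  have hdis : Disjoint K (f '' K) := by
    rw [Set.disjoint_right]
    rintro _ ⟨x, hx, rfl⟩
    exact hfree x hx
  obtain ⟨V, V', hV, hV', hKV, hKV', hVV⟩ :=
    SeparatedNhds.of_isCompact_isCompact hK (hK.image f.continuous) hdis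
  have hO : IsOpen ((V ∩ f ⁻¹' V') ∩ W) := (hV.inter (hV'.preimage f.continuous)).inter hW
  have hKO : K ⊆ (V ∩ f ⁻¹' V') ∩ W := fun x hx =>
    ⟨⟨hKV hx, hKV' (mem_image_of_mem f hx)⟩, hKW hx⟩
  have hsub := connectedComponentIn_subset ((V ∩ f ⁻¹' V') ∩ W) p
  refine ⟨connectedComponentIn ((V ∩ f ⁻¹' V') ∩ W) p, hO.connectedComponentIn,
    isPreconnected_connectedComponentIn, hKc.subset_connectedComponentIn hp hKO,
    fun x hx => (hsub hx).2, fun x hx hfx => ?_⟩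
  exact hVV.le_bot ⟨(hsub hfx).1.1, (hsub hx).1.2⟩

lemma close_free (f : ℂ ≃ₜ ℂ) (hf : IsoId f) (hfix : ∀ z, f z ≠ z)
    (K : Set ℂ) (hK : IsCompact K) (hKc : IsPreconnected K) (hfree : ∀ x ∈ K, f x ∉ K)
    {p q : ℂ} (hp : p ∈ K) (hq : q ∈ K) {m : ℕ} (hm : 1 ≤ m) (hpq : f^[m] p = q) :
    ∃ g : ℂ ≃ₜ ℂ, IsoId g ∧ (∀ z, g z ≠ z) ∧ ∃ j, 1 ≤ j ∧ j ≤ m ∧ ∃ x, g^[j] x = x := by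
  classical
  obtain ⟨U, hU, hUc, hKU, -, hUf⟩ :=
    thicken_free f K univ hK hKc isOpen_univ (subset_univ _) hfree
  have hex : ∃ j, 1 ≤ j ∧ f^[j] p ∈ U := ⟨m, hm, hpq ▸ hKU hq⟩
  have hspec := Nat.find_spec hex
  obtain ⟨g, g1, g2, g3⟩ := chain_close (ι := Unit) f hf hfix (fun _ => U) (fun _ => hU)
    (fun _ => hUc) (fun i j h => (h rfl).elim) (fun _ => hUf)
    (fun _ => f^[Nat.find hex] p) (fun _ => p) (fun _ => hspec.2) (fun _ => hKU hp) id
    (fun _ => Nat.find hex) (fun _ => hspec.1) (fun _ => rfl)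
    (fun _ l h0 hl _ hmem => Nat.find_min hex hl ⟨h0, hmem⟩)
  exact ⟨g, g1, g2, Nat.find hex, hspec.1, Nat.find_min' hex ⟨hm, hpq ▸ hKU hq⟩, p, g3 ()⟩

lemma ball_arc (f : ℂ ≃ₜ ℂ) (hfix : ∀ z, f z ≠ z) (x : ℂ) :
    ∃ β : ℝ → ℂ, Continuous β ∧ β 1 = f (β 0) ∧ β (1 / 2) = x ∧
      ∀ a ∈ Icc (0 : ℝ) 1, ∀ b ∈ Icc (0 : ℝ) 1, β a = f (β b) → a = 0 ∧ b = 1 ∨ a = 1 ∧ b = 0 := by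
  set g : ℂ → ℝ := fun p => max (dist p x) (dist (f p) x) with hg
  have hgc : Continuous g := by
    have := f.continuous
    fun_prop
  obtain ⟨y, hy⟩ : ∃ y, ∀ p, g y ≤ g p := by
    refine hgc.exists_forall_le' x ?_
    have : ∀ᶠ p in cocompact ℂ, g x ≤ dist p x :=
      (tendsto_dist_right_cocompact_atTop x).eventually_ge_atTop (g x)
    filter_upwards [this] with p hp
    exact hp.trans (le_max_left _ _)
  set r := g y with hr
  have hr0 : 0 < r := by
    by_contra hn
    have h1 : dist y x ≤ 0 := (le_max_left _ _).trans (not_lt.1 hn)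
    have h2 : dist (f y) x ≤ 0 := (le_max_right _ _).trans (not_lt.1 hn)
    rw [dist_le_zero] at h1 h2
    exact hfix y (h2.trans h1.symm)
  -- moving a point towards `x`
  have hmove : ∀ q : ℂ, ∀ ε : ℝ, 0 < ε → ε < 1 → dist q x ≤ r →
      dist (q + ε * (x - q)) x < r := by
    intro q ε h0 h1 hq
    have : q + ε * (x - q) - x = ((1 - ε : ℝ) : ℂ) * (q - x) := by push_cast; ring
    rw [dist_eq_norm, this, norm_mul, Complex.norm_real, Real.norm_eq_abs,
      abs_of_pos (by linarith), ← dist_eq_norm]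
    nlinarith [dist_nonneg (x := q) (y := x)]
  have hcont : ∀ q : ℂ, Tendsto (fun ε : ℝ => q + ε * (x - q)) (𝓝[>] 0) (𝓝 q) := by
    intro q
    have : Continuous (fun ε : ℝ => q + ε * (x - q)) := by fun_prop
    have h := this.tendsto 0
    simp only [Complex.ofReal_zero, zero_mul, add_zero] at h
    exact h.mono_left nhdsWithin_le_nhds
  have h01 : ∀ᶠ ε : ℝ in 𝓝[>] 0, 0 < ε ∧ ε < 1 := Ioo_mem_nhdsGT one_pos
  have key1 : ∀ p, dist p x ≤ r → dist (f p) x ≤ r → dist p x = r := by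
    intro p h1 h2
    by_contra hne
    have hlt := lt_of_le_of_ne h1 hne
    have ht := (f.symm.continuous.tendsto (f p)).comp (hcont (f p))
    have ht2 := (ht.dist (tendsto_const_nhds (x := x)))
    simp only [Homeomorph.symm_apply_apply] at ht2
    obtain ⟨ε, hε, h0, h1⟩ := ((ht2.eventually_lt_const hlt).and h01).exists
    have hmv := hmove (f p) ε h0 h1 h2
    have := hy (f.symm (f p + ε * (x - f p)))
    simp only [hg, Homeomorph.apply_symm_apply] at this
    exact absurd this (not_le.2 (max_lt hε hmv))
  have key2 : ∀ p, dist p x ≤ r → dist (f p) x ≤ r → dist (f p) x = r := by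
    intro p h1 h2
    by_contra hne
    have hlt := lt_of_le_of_ne h2 hne
    have ht := (f.continuous.tendsto p).comp (hcont p)
    have ht2 := (ht.dist (tendsto_const_nhds (x := x)))
    obtain ⟨ε, hε, h0, h3⟩ := ((ht2.eventually_lt_const hlt).and h01).exists
    exact absurd (hy (p + ε * (x - p))) (not_le.2 (max_lt (hmove p ε h0 h3 h1) hε))
  have hy1 : dist y x = r := key1 y (le_max_left _ _) (le_max_right _ _)
  have hy2 : dist (f y) x = r := key2 y (le_max_left _ _) (le_max_right _ _)
  set β : ℝ → ℂ := fun t =>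
    x + ((max 0 (1 - 2 * t) : ℝ) : ℂ) * (y - x) + ((max 0 (2 * t - 1) : ℝ) : ℂ) * (f y - x) with hβ
  have hβ0 : β 0 = y := by simp [hβ]
  have hβ1 : β 1 = f y := by
    simp only [hβ]; norm_num
  have hdist : ∀ t, dist (β t) x = |1 - 2 * t| * r := by
    intro t
    rcases le_total (1 - 2 * t) 0 with h | h
    · have : β t - x = ((2 * t - 1 : ℝ) : ℂ) * (f y - x) := by
        simp only [hβ]; rw [max_eq_left h, max_eq_right (by linarith)]; simp
      rw [dist_eq_norm, this, norm_mul, Complex.norm_real, Real.norm_eq_abs,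
        ← dist_eq_norm (f y) x, hy2, abs_sub_comm]
    · have : β t - x = ((1 - 2 * t : ℝ) : ℂ) * (y - x) := by
        simp only [hβ]; rw [max_eq_right h, max_eq_left (by linarith)]; simp
      rw [dist_eq_norm, this, norm_mul, Complex.norm_real, Real.norm_eq_abs,
        ← dist_eq_norm y x, hy1]
  have hle : ∀ t ∈ Icc (0 : ℝ) 1, dist (β t) x ≤ r := by
    intro t ht
    rw [hdist]
    have : |1 - 2 * t| ≤ 1 := abs_le.2 ⟨by linarith [ht.2], by linarith [ht.1]⟩
    nlinarith
  have hend : ∀ t ∈ Icc (0 : ℝ) 1, dist (β t) x = r → t = 0 ∨ t = 1 := by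
    intro t ht h
    rw [hdist] at h
    have h1 : |1 - 2 * t| = 1 := by
      have : (|1 - 2 * t| - 1) * r = 0 := by linarith
      rcases mul_eq_zero.1 this with h | h <;> linarith
    rcases (abs_eq zero_le_one).1 h1 with h | h
    · left; linarith
    · right; linarith
  refine ⟨β, by fun_prop, by rw [hβ0, hβ1], by simp [hβ], ?_⟩
  intro a ha b hb hab
  have h1 := hle a ha
  have h2 := hle b hb
  have h3 := key1 (β b) h2 (hab ▸ h1)
  have h4 := key2 (β b) h2 (hab ▸ h1)
  rw [← hab] at h4
  rcases hend a ha h4 with rfl | rfl <;> rcases hend b hb h3 with rfl | rfl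
  · exact absurd hab.symm (hfix _)
  · exact Or.inl ⟨rfl, rfl⟩
  · exact Or.inr ⟨rfl, rfl⟩
  · exact absurd hab.symm (hfix _)

lemma exists_line (f : ℂ ≃ₜ ℂ) (β : ℝ → ℂ) (hβ : Continuous β) (h1 : β 1 = f (β 0)) :
    ∃ Γ : ℝ → ℂ, Continuous Γ ∧ (∀ t, Γ (t + 1) = f (Γ t)) ∧ ∀ t ∈ Icc (0 : ℝ) 1, Γ t = β t := by
  set Γ : ℝ → ℂ := fun t => (f ^ ⌊t⌋) (β (Int.fract t)) with hΓ
  have hloc : ∀ k : ℤ, ∀ t ∈ Icc (k : ℝ) (k + 1), Γ t = (f ^ k) (β (t - k)) := by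
    intro k t ht
    rcases eq_or_lt_of_le ht.2 with h | h
    · have hfl : ⌊t⌋ = k + 1 := by rw [h]; simp
      have hfr : Int.fract t = 0 := by rw [h]; simp
      have e : t - k = 1 := by linarith
      simp only [hΓ, hfl, hfr, e, h1, zpow_add_one, Homeomorph.mul_apply]
    · have hfl : ⌊t⌋ = k := Int.floor_eq_iff.2 ⟨ht.1, h⟩
      simp only [hΓ, Int.fract, hfl]
  refine ⟨Γ, ?_, ?_, ?_⟩
  · have hlf : LocallyFinite (fun k : ℤ => Icc (k : ℝ) (k + 1)) := by
      intro t
      refine ⟨Ioo (t - 1) (t + 1), Ioo_mem_nhds (by linarith) (by linarith), ?_⟩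
      refine (Set.finite_Icc (⌊t⌋ - 3) (⌊t⌋ + 3)).subset ?_
      rintro k ⟨z, hz, hz'⟩
      have h1 := Int.floor_le t
      have h2 := Int.lt_floor_add_one t
      have h3 := hz.1
      have h4 := hz.2
      have h5 := hz'.1
      have h6 := hz'.2
      constructor
      · have : ((⌊t⌋ - 3 : ℤ) : ℝ) ≤ k := by push_cast; linarith
        exact_mod_cast this
      · have : (k : ℝ) ≤ ((⌊t⌋ + 3 : ℤ) : ℝ) := by push_cast; linarith
        exact_mod_cast this
    refine hlf.continuous ?_ (fun k => isClosed_Icc) ?_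
    · refine eq_univ_of_forall fun t => mem_iUnion.2 ⟨⌊t⌋, Int.floor_le t, (Int.lt_floor_add_one t).le⟩
    · intro k
      have : Continuous (fun t : ℝ => (f ^ k) (β (t - k))) :=
        (f ^ k).continuous.comp (hβ.comp (by fun_prop))
      exact this.continuousOn.congr (hloc k)
  · intro t
    simp only [hΓ, Int.floor_add_one, Int.fract_add_one]
    rw [add_comm, zpow_add, zpow_one, Homeomorph.mul_apply]
  · intro t ht
    have := hloc 0 t (by simpa using ht)
    simpa using this

theorem no_periodic (n : ℕ) : 1 ≤ n → ∀ f : ℂ ≃ₜ ℂ, IsoId f → (∀ z, f z ≠ z) → ∀ x, f^[n] x ≠ x := by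
  induction n using Nat.strong_induction_on with
  | _ n IH =>
  intro hn f hf hfix x hx
  rcases eq_or_lt_of_le hn with rfl | hn2
  · exact hfix x hx
  obtain ⟨β, hβ, hβ1, hβx, hβf⟩ := ball_arc f hfix x
  obtain ⟨Γ, hΓ, hsh, hΓβ⟩ := exists_line f β hβ hβ1
  have hshn : ∀ (m : ℕ) t, Γ (t + m) = f^[m] (Γ t) := by
    intro m t
    induction m with
    | zero => simp
    | succ m ih => 
      rw [Function.iterate_succ_apply', ← ih, ← hsh]; congr 1; push_cast; ring
  have hfree : ∀ u w : ℝ, 0 ≤ u → w ≤ 1 → w - u < 1 → ∀ z ∈ β '' Icc u w, f z ∉ β '' Icc u w := by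
    rintro u w hu hw huw _ ⟨b, hb, rfl⟩ ⟨a, ha, hab⟩
    rcases hβf a ⟨hu.trans ha.1, ha.2.trans hw⟩ b ⟨hu.trans hb.1, hb.2.trans hw⟩ hab with h | h
    · linarith [h.1, h.2, ha.1, hb.2]
    · linarith [h.1, h.2, ha.2, hb.1]
  -- closing up along a sub-arc
  have hclose : ∀ u w p q : ℝ, 0 ≤ u → w ≤ 1 → w - u < 1 → p ∈ Icc u w → q ∈ Icc u w →
      ∀ m : ℕ, 1 ≤ m → m < n → f^[m] (β p) ≠ β q := by
    intro u w p q hu hw huw hp hq m hm hmn h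
    obtain ⟨g, g1, g2, j, j1, j2, y, hy⟩ := close_free f hf hfix (β '' Icc u w)
      (isCompact_Icc.image hβ) (isPreconnected_Icc.image _ hβ.continuousOn) (hfree u w hu hw huw)
      (mem_image_of_mem β hp) (mem_image_of_mem β hq) hm h
    exact IH j (by omega) j1 g g1 g2 y hy
  have hcoin0 : ∀ s d : ℝ, 0 ≤ s → s < 1 → 1 ≤ d → d ≤ n - 1 → Γ s ≠ Γ (s + d) := by
    intro s d hs0 hs1 hd1 hd2 h
    obtain ⟨m, r, hr0, hr1, rfl⟩ : ∃ (m : ℕ) (r : ℝ), 0 ≤ r ∧ r < 1 ∧ d = r + m :=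
      ⟨⌊d⌋₊, d - ⌊d⌋₊, by linarith [Nat.floor_le (show 0 ≤ d by linarith)],
        by linarith [Nat.lt_floor_add_one d], by ring⟩
    have hm1 : 1 ≤ m := by
      by_contra hm
      have : m = 0 := by omega
      subst this
      simp at hd1
      linarith
    rw [← add_assoc, hshn] at h
    have hΓs : Γ s = β s := hΓβ s ⟨hs0, hs1.le⟩
    rcases eq_or_lt_of_le hr0 with rfl | hr
    · have hmn : m < n := by
        have : (m : ℝ) < n := by linarith
        exact_mod_cast this
      rw [add_zero] at h
      exact IH m hmn hm1 f hf hfix _ h.symm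
    · have hmn : m + 1 < n := by
        have : ((m + 1 : ℕ) : ℝ) < n := by push_cast; linarith
        exact_mod_cast this
      rcases le_or_gt (s + r) 1 with hsr | hsr
      · rw [hΓs, hΓβ (s + r) ⟨by linarith, hsr⟩] at h
        exact hclose s (s + r) (s + r) s hs0 hsr (by linarith) ⟨by linarith, le_rfl⟩
          ⟨le_rfl, by linarith⟩ m hm1 (by omega) h.symm
      · have e : s + r = (s + r - 1) + 1 := by ring
        rw [e, hsh, ← Function.iterate_succ_apply, hΓs,
          hΓβ (s + r - 1) ⟨by linarith, by linarith⟩] at h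
        exact hclose (s + r - 1) s (s + r - 1) s (by linarith) hs1.le (by linarith)
          ⟨le_rfl, by linarith⟩ ⟨by linarith, le_rfl⟩ (m + 1) (by omega) hmn h.symm
  have hcoin : ∀ s d : ℝ, 0 ≤ s → 1 ≤ d → d ≤ n - 1 → Γ s ≠ Γ (s + d) := by
    intro s d hs hd1 hd2 h
    have e1 : s = (s - ⌊s⌋₊) + (⌊s⌋₊ : ℕ) := by ring
    have e2 : s + d = (s - ⌊s⌋₊ + d) + (⌊s⌋₊ : ℕ) := by ring
    rw [e2, hshn] at h
    nth_rw 1 [e1] at h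
    rw [hshn] at h
    have := f.injective.iterate _ h
    exact hcoin0 _ d (by linarith [Nat.floor_le hs]) (by linarith [Nat.lt_floor_add_one s])
      hd1 hd2 this
  obtain ⟨F, hF, hF0, hF1, hFi⟩ := hf
  refine winding_contra f f.continuous hfix F hF hF0 hF1 hFi n (by exact_mod_cast hn2)
    (fun t => Γ (t + 1 / 2)) (by fun_prop) ?_ ?_ ?_
  · intro t
    rw [← hsh]; congr 1; ring
  · rw [add_comm, hshn, zero_add, hΓβ (1 / 2) ⟨by norm_num, by norm_num⟩, hβx, hx]
  · intro s t hs ht h1 h2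
    have := hcoin (s + 1 / 2) (t - s) (by linarith) h1 h2
    have e : s + 1 / 2 + (t - s) = t + 1 / 2 := by ring
    rwa [e] at this

lemma no_cycle {ι : Type} [Finite ι] [Nonempty ι] (f : ℂ ≃ₜ ℂ) (hf : IsoId f)
    (hfix : ∀ z, f z ≠ z) (U : ι → Set ℂ) (hU : ∀ i, IsOpen (U i))
    (hc : ∀ i, IsPreconnected (U i)) (hd : ∀ i j, i ≠ j → Disjoint (U i) (U j))
    (hfree : ∀ i, ∀ x ∈ U i, f x ∉ U i) (p : ι → ℂ) (hp : ∀ i, p i ∈ U i)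
    (h : ∀ i, ∃ m, 1 ≤ m ∧ ∃ j, f^[m] (p i) ∈ U j) : False := by
  classical
  have h' : ∀ i, ∃ m, 1 ≤ m ∧ (∃ j, f^[m] (p i) ∈ U j) ∧
      ∀ l, 0 < l → l < m → ∀ j, f^[l] (p i) ∉ U j := by
    intro i
    refine ⟨Nat.find (h i), (Nat.find_spec (h i)).1, (Nat.find_spec (h i)).2, ?_⟩
    intro l h0 hl j hj
    exact Nat.find_min (h i) hl ⟨h0, j, hj⟩
  choose m hm hj hout using h'
  choose σ hσ using hj
  have hbij := Function.bijOn_periodicPts σ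
  let τ : Function.periodicPts σ → Function.periodicPts σ := hbij.mapsTo.restrict σ _ _
  have hτi : Function.Injective τ := fun x y hxy =>
    Subtype.ext (hbij.injOn x.2 y.2 (congrArg Subtype.val hxy))
  have hτ : Function.Bijective τ := Finite.injective_iff_bijective.1 hτi
  let e := Equiv.ofBijective τ hτ
  obtain ⟨i0, hi0⟩ : (Function.periodicPts σ).Nonempty := by
    obtain ⟨i⟩ := ‹Nonempty ι›
    obtain ⟨x, y, hxy, he⟩ := Finite.exists_ne_map_eq_of_infinite (fun n : ℕ => σ^[n] i)
    wlog hlt : x < y generalizing x y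
    · exact this y x hxy.symm he.symm (by omega)
    refine ⟨σ^[x] i, Function.mk_mem_periodicPts (n := y - x) (by omega) ?_⟩
    show σ^[y - x] (σ^[x] i) = σ^[x] i
    rw [← Function.iterate_add_apply, Nat.sub_add_cancel hlt.le]; exact he.symm
  obtain ⟨g, hg, hgfix, hgm⟩ := chain_close (ι := Function.periodicPts σ) f hf hfix
    (fun i => U i) (fun i => hU i) (fun i => hc i)
    (fun i j hij => hd i j (fun hh => hij (Subtype.ext hh))) (fun i => hfree i)
    (fun i => f^[m (e.symm i)] (p (e.symm i))) (fun i => p i)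
    (fun i => by
      have := hσ (e.symm i)
      have h2 : σ (e.symm i) = i := congrArg Subtype.val (e.apply_symm_apply i)
      rwa [h2] at this)
    (fun i => hp i) τ (fun i => m i) (fun i => hm i)
    (fun i => by
      have : e.symm (τ i) = i := e.symm_apply_apply i
      simp only [this])
    (fun i l h0 hl j => hout i l h0 hl j)
  have hit : ∀ l : ℕ, ∀ i, ∃ M, l ≤ M ∧ g^[M] (p (i : Function.periodicPts σ)) = p (τ^[l] i) := by
    intro l
    induction l with
    | zero => exact fun i => ⟨0, le_rfl, rfl⟩
    | succ l ih =>
      intro i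
      obtain ⟨M, hM, he⟩ := ih (τ i)
      refine ⟨M + m i, by have := hm i; omega, ?_⟩
      rw [Function.iterate_add_apply, hgm, he, Function.iterate_succ_apply]
  obtain ⟨l, hl, hper⟩ := hi0
  obtain ⟨M, hM, he⟩ := hit l ⟨i0, l, hl, hper⟩
  have hval : ∀ l : ℕ, ∀ i, ((τ^[l] i : Function.periodicPts σ) : ι) = σ^[l] i := by
    intro l
    induction l with
    | zero => exact fun i => rfl
    | succ l ih => intro i; rw [Function.iterate_succ_apply, ih, Function.iterate_succ_apply]; rfl
  rw [hval] at he
  have : σ^[l] i0 = i0 := hper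
  simp only [this] at he
  exact no_periodic M (by omega) g hg hgfix _ he

lemma disj_nhds {ι : Type} [Finite ι] (K : ι → Set ℂ) (hK : ∀ i, IsCompact (K i))
    (hd : ∀ i j, i ≠ j → Disjoint (K i) (K j)) :
    ∃ W : ι → Set ℂ, (∀ i, IsOpen (W i)) ∧ (∀ i, K i ⊆ W i) ∧
      ∀ i j, i ≠ j → Disjoint (W i) (W j) := by
  have h : ∀ i j, ∃ A B : Set ℂ, IsOpen A ∧ IsOpen B ∧ K i ⊆ A ∧ K j ⊆ B ∧
      (i ≠ j → Disjoint A B) := by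
    intro i j
    by_cases hij : i = j
    · exact ⟨univ, univ, isOpen_univ, isOpen_univ, subset_univ _, subset_univ _,
        fun h => absurd hij h⟩
    · obtain ⟨A, B, h1, h2, h3, h4, h5⟩ :=
        SeparatedNhds.of_isCompact_isCompact (hK i) (hK j) (hd i j hij)
      exact ⟨A, B, h1, h2, h3, h4, fun _ => h5⟩
  choose A B hA hB hKA hKB hAB using h
  refine ⟨fun i => ⋂ j, (A i j ∩ B j i), fun i => isOpen_iInter_of_finite
    fun j => (hA i j).inter (hB j i), fun i => subset_iInter
    fun j => subset_inter (hKA i j) (hKB j i), ?_⟩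
  intro i j hij
  refine (hAB i j hij).mono ?_ ?_
  · exact (iInter_subset _ j).trans inter_subset_left
  · exact (iInter_subset _ i).trans inter_subset_right

lemma add_iter (f : ℂ ≃ₜ ℂ) (w : ℂ) (hf : ∀ z, f z = z + w) (m : ℕ) (z : ℂ) :
    f^[m] z = z + m * w := by
  induction m with
  | zero => simp
  | succ m ih => rw [Function.iterate_succ_apply', ih, hf]; push_cast; ring

end CurveAux


/-- Translate of a planar set by a vector. -/
def setTranslate (A : Set (ℝ × ℝ)) (v : ℝ × ℝ) : Set (ℝ × ℝ) := (· + v) '' A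

/-- There do not exist `k` pairwise-disjoint simple curves, each disjoint from its
own setTranslate by a nonzero vector `v`, such that the `i`-th curve runs from `pᵢ`
to `p_{i+1} + n_{i+1} • v` (indices cyclic) with each `nᵢ` a positive integer. -/
theorem no_cyclic_curve_system (k : ℕ) [NeZero k]
    (p : Fin k → ℝ × ℝ) (n : Fin k → ℕ) (hn : ∀ i, 1 ≤ n i)
    (v : ℝ × ℝ) (hv : v ≠ 0) :
    ¬ ∃ φ : Fin k → ℝ → ℝ × ℝ,
        (∀ i, ContinuousOn (φ i) (Set.Icc 0 1)) ∧
        (∀ i, Set.InjOn (φ i) (Set.Icc 0 1)) ∧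
        (∀ i, φ i 0 = p i ∧ φ i 1 = p (i + 1) + ((n (i + 1) : ℝ)) • v) ∧
        (∀ i, (φ i '' Set.Icc 0 1) ∩ setTranslate (φ i '' Set.Icc 0 1) v = ∅) ∧
        (∀ i j : Fin k, i < j →
          (φ i '' Set.Icc 0 1) ∩ (φ j '' Set.Icc 0 1) = ∅) := by
  rintro ⟨φ, hcont, -, hends, hself, hdisj⟩
  let L := Complex.equivRealProdCLM.symm
  have hadd : ∀ a b : ℝ × ℝ, L (a + b) = L a + L b := fun a b => map_add L a b
  have hw : L v ≠ 0 := fun h => hv ((map_eq_zero_iff L L.injective).1 h)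
  let T : ℂ ≃ₜ ℂ := Homeomorph.addRight (L v)
  have hT : ∀ z, T z = z + L v := fun z => rfl
  have hTfix : ∀ z, T z ≠ z := fun z h => hw (by rw [hT] at h; simpa using h)
  have hTiso : CurveAux.IsoId T := by
    refine ⟨fun q => q.2 + (q.1 : ℂ) * L v, by fun_prop, fun z => by simp,
      fun z => by simp [hT], fun u x y h => by simpa using h⟩
  let K : Fin k → Set ℂ := fun i => L '' (φ i '' Set.Icc 0 1)
  have hKc : ∀ i, IsCompact (K i) := fun i =>
    (isCompact_Icc.image_of_continuousOn (hcont i)).image L.continuous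
  have hKp : ∀ i, IsPreconnected (K i) := fun i =>
    (isPreconnected_Icc.image _ (hcont i)).image _ L.continuous.continuousOn
  have hKfree : ∀ i, ∀ x ∈ K i, T x ∉ K i := by
    rintro i _ ⟨a, ha, rfl⟩ ⟨b, hb, he⟩
    rw [hT, ← hadd] at he
    have : b = a + v := L.injective he
    have hmem : b ∈ (φ i '' Set.Icc 0 1) ∩ setTranslate (φ i '' Set.Icc 0 1) v :=
      ⟨hb, a, ha, this.symm⟩
    rw [hself i] at hmem
    exact hmem
  have hKlt : ∀ i j, i < j → Disjoint (K i) (K j) := fun i j hij =>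
    (Set.disjoint_image_iff L.injective).2 (Set.disjoint_iff_inter_eq_empty.2 (hdisj i j hij))
  have hKd : ∀ i j, i ≠ j → Disjoint (K i) (K j) := fun i j hij =>
    hij.lt_or_gt.elim (hKlt i j) fun h => (hKlt j i h).symm
  obtain ⟨W, hWo, hKW, hWd⟩ := CurveAux.disj_nhds K hKc hKd
  choose U hUo hUp hKU hUW hUf using fun i =>
    CurveAux.thicken_free T (K i) (W i) (hKc i) (hKp i) (hWo i) (hKW i) (hKfree i)
  refine CurveAux.no_cycle T hTiso hTfix U hUo hUp
    (fun i j hij => (hWd i j hij).mono (hUW i) (hUW j)) hUf (fun i => L (p i)) ?_ ?_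
  · intro i
    exact hKU i ⟨p i, ⟨0, by simp, (hends i).1⟩, rfl⟩
  · intro i
    refine ⟨n i, hn i, i - 1, hKU _ ⟨φ (i - 1) 1, ⟨1, by simp, rfl⟩, ?_⟩⟩
    rw [(hends (i - 1)).2, sub_add_cancel, hadd, CurveAux.add_iter T (L v) hT, map_smul]
    simp
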